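/- Let P_1 ≠ P_2 be two points of P^1 and let Q_1, Q_2, Q_3, Q_4, Q_5 be five generic points of P^2 (in general position: no two equal, no three collinear, every subset with generic Hilbert function). Then X' = {P_1 × Q_1, P_2 × Q_2, P_1 × Q_3, P_2 × Q_3, P_1 × Q_4, P_2 × Q_4} is not ACM, while X'' = X' ∪ {P_1 × Q_5, P_2 × Q_5}, which contains X' as a subconfiguration, is ACM. -/

import Mathlib

noncomputable section

/-- Points of projective `m`-space over the field `k`. -/
abbrev Pt (k : Type) [Field k] (m : ℕ) := Projectivization k (Fin (m + 1) → k)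

set_option synthInstance.maxHeartbeats 1000000 in
/-- An ideal `I` of a polynomial ring defines an *arithmetically Cohen–Macaulay* (ACM)
quotient if there is a regular sequence on `R/I`, consisting of elements of the irrelevant
maximal ideal (generated by the images of the variables), whose length equals the Krull
dimension of `R/I`.  For a graded quotient of a polynomial ring this says exactly that the
depth of the irrelevant maximal ideal on `R/I` equals the Krull dimension, i.e. that `R/I`
is a Cohen–Macaulay ring. -/
def IsACM {k : Type} [Field k] {σ : Type} (I : Ideal (MvPolynomial σ k)) : Prop :=
  ∃ rs : List (MvPolynomial σ k ⧸ I),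
    (∀ r ∈ rs,
      r ∈ Ideal.map (Ideal.Quotient.mk I)
            (Ideal.span (Set.range (MvPolynomial.X : σ → MvPolynomial σ k)))) ∧
    RingTheory.Sequence.IsRegular (MvPolynomial σ k ⧸ I) rs ∧
    (rs.length : WithBot ℕ∞) = ringKrullDim (MvPolynomial σ k ⧸ I)

variable (k : Type) [Field k]

/-- The homogeneous (saturated) vanishing ideal of a set of points of `ℙ^m`:
all polynomials vanishing on the affine cone over the points. -/
def vanishP {m : ℕ} (Z : Set (Pt k m)) : Ideal (MvPolynomial (Fin (m + 1)) k) :=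
  ⨅ (q : Pt k m) (_ : q ∈ Z) (s : k),
    RingHom.ker (MvPolynomial.eval (s • q.rep))

/-- The bihomogeneous (saturated) vanishing ideal of a set of points of `ℙ^a × ℙ^b`:
all polynomials vanishing on the multicone over the points. -/
def vanishP2 {a b : ℕ} (X : Set (Pt k a × Pt k b)) :
    Ideal (MvPolynomial (Fin (a + 1) ⊕ Fin (b + 1)) k) :=
  ⨅ (p : Pt k a × Pt k b) (_ : p ∈ X) (s : k) (t : k),
    RingHom.ker (MvPolynomial.eval (Sum.elim (s • p.1.rep) (t • p.2.rep)))

/-- The `(⋆)`-property for a finite set of points in `ℙ^a × ℙ^b`. -/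
def StarProp {a b : ℕ} (X : Set (Pt k a × Pt k b)) : Prop :=
  ∀ p ∈ X, ∀ q ∈ X, (p.1, q.2) ∈ X ∨ (q.1, p.2) ∈ X

/-- The Hilbert function of the quotient by an ideal `I` of a polynomial ring:
`i ↦ dim_k S_i − dim_k (I ∩ S_i)`. -/
def hilbFn {σ : Type} (I : Ideal (MvPolynomial σ k)) (i : ℕ) : ℕ :=
  Module.finrank k (MvPolynomial.homogeneousSubmodule σ k i) -
  Module.finrank k
    ((Submodule.restrictScalars k I ⊓ MvPolynomial.homogeneousSubmodule σ k i :
      Submodule k (MvPolynomial σ k)))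

/-- A set of points of `ℙ^m` has generic Hilbert function:
`H_Z(i) = min (C(i+m,m), #Z)` for all `i`. -/
def GenericHF {m : ℕ} (Z : Set (Pt k m)) : Prop :=
  ∀ i : ℕ, hilbFn k (vanishP k Z) i = min (Nat.choose (i + m) m) Z.ncard

section RegularSequences

open RingTheory.Sequence Pointwise

theorem isWeaklyRegular_pair_iff {S : Type*} [CommRing S] (f g : S) :
    IsWeaklyRegular S [f, g] ↔
      (∀ x, f * x = 0 → x = 0) ∧ ∀ x y, g * x = f * y → ∃ z, x = f * z := by
  have hmem : ∀ x : S, x ∈ f • (⊤ : Submodule S S) ↔ ∃ z, x = f * z := fun x => by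
    simp [Submodule.mem_smul_pointwise_iff_exists, eq_comm]
  rw [isWeaklyRegular_cons_iff, isWeaklyRegular_cons_iff,
    and_iff_left (IsWeaklyRegular.nil S _), isSMulRegular_iff_right_eq_zero_of_smul,
    isSMulRegular_iff_right_eq_zero_of_smul]
  refine and_congr Iff.rfl ⟨fun h x y hxy => ?_, fun h x => ?_⟩
  · rw [← hmem, ← Submodule.Quotient.mk_eq_zero]
    refine h _ ?_
    rw [← Submodule.Quotient.mk_smul, Submodule.Quotient.mk_eq_zero, hmem]
    exact ⟨y, hxy⟩
  · obtain ⟨x, rfl⟩ := Submodule.Quotient.mk_surjective _ x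
    rw [← Submodule.Quotient.mk_smul, Submodule.Quotient.mk_eq_zero, hmem,
      Submodule.Quotient.mk_eq_zero, hmem]
    rintro ⟨y, hy⟩
    exact h x y hy

theorem isWeaklyRegular_mk_pair_iff {R : Type*} [CommRing R] (I : Ideal R) (f g : R) :
    IsWeaklyRegular (R ⧸ I) [Ideal.Quotient.mk I f, Ideal.Quotient.mk I g] ↔
      (∀ h, f * h ∈ I → h ∈ I) ∧
        ∀ h h', g * h - f * h' ∈ I → ∃ h'', h - f * h'' ∈ I := by
  simp only [isWeaklyRegular_pair_iff, Ideal.Quotient.mk_surjective.forall,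
    Ideal.Quotient.mk_surjective.exists, ← map_mul, Ideal.Quotient.eq,
    Ideal.Quotient.eq_zero_iff_mem]

theorem isRegular_of_isWeaklyRegular_of_map_eq_zero {S K : Type*} [CommRing S] [CommRing K]
    [Nontrivial K] (φ : S →+* K) {rs : List S} (hrs : ∀ r ∈ rs, φ r = 0)
    (h : IsWeaklyRegular S rs) : IsRegular S rs := by
  refine ⟨h, fun htop => ?_⟩
  have hker : Ideal.ofList rs ≤ RingHom.ker φ := Ideal.span_le.2 hrs
  have hle : (⊤ : Submodule S S) ≤ RingHom.ker φ := htop.trans_le <|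
    Submodule.smul_le.2 fun r hr x _ => Ideal.mul_mem_right x _ (hker hr)
  exact RingHom.ker_ne_top φ (top_le_iff.1 hle)

end RegularSequences

section FiniteIntersections

variable {R ι : Type*} [CommRing R] {J : ι → Ideal R} {s : Set ι}

theorem exists_le_of_biInf_le_prime (hs : s.Finite) {P : Ideal R} [P.IsPrime]
    (h : ⨅ i ∈ s, J i ≤ P) : ∃ i ∈ s, J i ≤ P := by
  have := (Ideal.IsPrime.inf_le' (s := hs.toFinset) (f := J) (P := P) inferInstance).1
    (by simpa [Finset.inf_eq_iInf] using h)
  simpa using this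

theorem ringKrullDim_quotient_biInf_le (hs : s.Finite) {n : WithBot ℕ∞}
    (hn : ∀ i ∈ s, ringKrullDim (R ⧸ J i) ≤ n) :
    ringKrullDim (R ⧸ ⨅ i ∈ s, J i) ≤ n := by
  rw [ringKrullDim_quotient]
  refine iSup_le fun c => ?_
  obtain ⟨i, hi, hle⟩ := exists_le_of_biInf_le_prime hs (P := c.head.1.asIdeal) c.head.2
  refine le_trans ?_ (hn i hi)
  rw [ringKrullDim_quotient]
  exact le_iSup_of_le
    (⟨c.length, fun j => ⟨(c j).1, hle.trans (LTSeries.monotone c (Fin.zero_le j))⟩,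
      fun j => c.step j⟩ : LTSeries (PrimeSpectrum.zeroLocus (J i : Set R))) le_rfl

theorem notMem_of_regular_biInf (hs : s.Finite) (hJ : ∀ i ∈ s, (J i).IsPrime)
    (hinc : ∀ i ∈ s, ∀ j ∈ s, J j ≤ J i → j = i) {f : R}
    (hf : ∀ h, f * h ∈ ⨅ i ∈ s, J i → h ∈ ⨅ i ∈ s, J i) {i : ι} (hi : i ∈ s) : f ∉ J i := by
  intro hfi
  have := hJ i hi
  have hnle : ¬ ⨅ j ∈ s \ {i}, J j ≤ J i := fun hle => by
    obtain ⟨j, hj, hji⟩ := exists_le_of_biInf_le_prime hs.sdiff hle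
    exact hj.2 (hinc i hi j hj.1 hji)
  obtain ⟨g, hg, hgi⟩ := SetLike.not_le_iff_exists.1 hnle
  simp only [Submodule.mem_iInf] at hf hg
  refine hgi (hf g (fun j hj => ?_) i hi)
  by_cases hji : j = i
  · subst hji
    exact Ideal.mul_mem_right _ _ hfi
  · exact Ideal.mul_mem_left _ _ (hg j ⟨hj, hji⟩)

end FiniteIntersections

section Planes

variable {k} {σ τ : Type}

open MvPolynomial

/-- The ideal of polynomials vanishing at all points `(s • p, t • q)`. -/
def planeIdeal (p : σ → k) (q : τ → k) : Ideal (MvPolynomial (σ ⊕ τ) k) :=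
  ⨅ (s : k) (t : k), RingHom.ker (eval (Sum.elim (s • p) (t • q)))

theorem mem_planeIdeal {p : σ → k} {q : τ → k} {f : MvPolynomial (σ ⊕ τ) k} :
    f ∈ planeIdeal p q ↔ ∀ s t : k, eval (Sum.elim (s • p) (t • q)) f = 0 := by
  simp [planeIdeal, Submodule.mem_iInf]

/-- Restriction of polynomials to the plane `(s, t) ↦ (s • p, t • q)`. -/
def planeRestrict (p : σ → k) (q : τ → k) :
    MvPolynomial (σ ⊕ τ) k →ₐ[k] MvPolynomial (Fin 2) k :=
  aeval (Sum.elim (fun i => C (p i) * X 0) fun j => C (q j) * X 1)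

theorem eval_planeRestrict (p : σ → k) (q : τ → k) (f : MvPolynomial (σ ⊕ τ) k)
    (x : Fin 2 → k) :
    eval x (planeRestrict p q f) = eval (Sum.elim (x 0 • p) (x 1 • q)) f := by
  rw [planeRestrict, aeval_def, ← coe_eval₂Hom, ← RingHom.comp_apply]
  congr 1
  ext v
  · simp
  · rcases v with i | j <;> simp [mul_comm]

theorem planeRestrict_surjective {p : σ → k} {q : τ → k} (hp : p ≠ 0) (hq : q ≠ 0) :
    Function.Surjective (planeRestrict p q) := by
  obtain ⟨i, hi⟩ := Function.ne_iff.1 hp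
  obtain ⟨j, hj⟩ := Function.ne_iff.1 hq
  rw [← AlgHom.range_eq_top, ← top_le_iff, ← adjoin_range_X, Algebra.adjoin_le_iff]
  rintro _ ⟨a, rfl⟩
  fin_cases a
  · refine ⟨C (p i)⁻¹ * X (Sum.inl i), ?_⟩
    change planeRestrict p q _ = _
    rw [planeRestrict, map_mul, aeval_C, aeval_X, Sum.elim_inl, algebraMap_eq, ← mul_assoc, ← C_mul,
      inv_mul_cancel₀ hi, C_1, one_mul]
    rfl
  · refine ⟨C (q j)⁻¹ * X (Sum.inr j), ?_⟩
    change planeRestrict p q _ = _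
    rw [planeRestrict, map_mul, aeval_C, aeval_X, Sum.elim_inr, algebraMap_eq, ← mul_assoc, ← C_mul,
      inv_mul_cancel₀ hj, C_1, one_mul]
    rfl

theorem planeIdeal_eq_ker [Infinite k] (p : σ → k) (q : τ → k) :
    planeIdeal p q = RingHom.ker (planeRestrict p q) := by
  ext f
  rw [mem_planeIdeal, RingHom.mem_ker]
  refine ⟨fun h => MvPolynomial.funext fun x => ?_, fun h s t => ?_⟩
  · rw [eval_planeRestrict, h, map_zero]
  · simpa [h] using (eval_planeRestrict p q f ![s, t]).symm

theorem planeIdeal_isPrime [Infinite k] (p : σ → k) (q : τ → k) : (planeIdeal p q).IsPrime := by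
  rw [planeIdeal_eq_ker]
  exact RingHom.ker_isPrime _

theorem ringKrullDim_quotient_planeIdeal [Infinite k] {p : σ → k} {q : τ → k} (hp : p ≠ 0)
    (hq : q ≠ 0) : ringKrullDim (MvPolynomial (σ ⊕ τ) k ⧸ planeIdeal p q) = 2 := by
  have e := Ideal.quotientKerAlgEquivOfSurjective (planeRestrict_surjective hp hq)
  rw [planeIdeal_eq_ker, ringKrullDim_eq_of_ringEquiv e.toRingEquiv,
    MvPolynomial.ringKrullDim_of_isNoetherianRing]
  simp

theorem Projectivization.eq_of_rep_mul_rep {ι : Type*} {p q : Projectivization k (ι → k)}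
    (h : ∀ i j, p.rep i * q.rep j = p.rep j * q.rep i) : p = q := by
  obtain ⟨j, hj⟩ := Function.ne_iff.1 q.rep_nonzero
  rw [← p.mk_rep, ← q.mk_rep, Projectivization.mk_eq_mk_iff']
  refine ⟨p.rep j / q.rep j, _root_.funext fun i => ?_⟩
  rw [Pi.smul_apply, smul_eq_mul, div_mul_eq_mul_div, div_eq_iff hj, h]

theorem eq_of_planeIdeal_le {a b : ℕ} {x y : Pt k a × Pt k b}
    (h : planeIdeal y.1.rep y.2.rep ≤ planeIdeal x.1.rep x.2.rep) : y = x := by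
  refine Prod.ext ?_ ?_
  · refine (Projectivization.eq_of_rep_mul_rep fun i j => ?_).symm
    have : X (Sum.inl i) * C (y.1.rep j) - X (Sum.inl j) * C (y.1.rep i) ∈
        planeIdeal x.1.rep x.2.rep :=
      h (mem_planeIdeal.2 fun s t => by simp; ring)
    simpa [sub_eq_zero] using mem_planeIdeal.1 this 1 1
  · refine (Projectivization.eq_of_rep_mul_rep fun i j => ?_).symm
    have : X (Sum.inr i) * C (y.2.rep j) - X (Sum.inr j) * C (y.2.rep i) ∈
        planeIdeal x.1.rep x.2.rep :=
      h (mem_planeIdeal.2 fun s t => by simp; ring)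
    simpa [sub_eq_zero] using mem_planeIdeal.1 this 1 1

theorem vanishP2_eq_iInf_planeIdeal {a b : ℕ} (X : Set (Pt k a × Pt k b)) :
    vanishP2 k X = ⨅ x ∈ X, planeIdeal x.1.rep x.2.rep :=
  rfl

theorem mem_vanishP2 {a b : ℕ} {X : Set (Pt k a × Pt k b)}
    {f : MvPolynomial (Fin (a + 1) ⊕ Fin (b + 1)) k} :
    f ∈ vanishP2 k X ↔ ∀ x ∈ X, f ∈ planeIdeal x.1.rep x.2.rep := by
  simp only [vanishP2_eq_iInf_planeIdeal, Submodule.mem_iInf]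

theorem ringKrullDim_quotient_vanishP2 [Infinite k] {a b : ℕ} {X : Set (Pt k a × Pt k b)}
    (hX : X.Finite) (hne : X.Nonempty) :
    ringKrullDim (MvPolynomial (Fin (a + 1) ⊕ Fin (b + 1)) k ⧸ vanishP2 k X) = 2 := by
  have hdim (x : Pt k a × Pt k b) :=
    ringKrullDim_quotient_planeIdeal x.1.rep_nonzero x.2.rep_nonzero
  refine le_antisymm (ringKrullDim_quotient_biInf_le hX fun x _ => (hdim x).le) ?_
  obtain ⟨x, hx⟩ := hne
  rw [← hdim x]
  exact ringKrullDim_le_of_surjective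
    (Ideal.Quotient.factor (fun f hf => mem_vanishP2.1 hf x hx))
    (Ideal.Quotient.factor_surjective _)

theorem notMem_planeIdeal_of_regular [Infinite k] {a b : ℕ} {X : Set (Pt k a × Pt k b)}
    (hX : X.Finite) {f : MvPolynomial (Fin (a + 1) ⊕ Fin (b + 1)) k}
    (hf : ∀ h, f * h ∈ vanishP2 k X → h ∈ vanishP2 k X) {x : Pt k a × Pt k b} (hx : x ∈ X) :
    f ∉ planeIdeal x.1.rep x.2.rep :=
  notMem_of_regular_biInf (J := fun x : Pt k a × Pt k b => planeIdeal x.1.rep x.2.rep) hX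
    (fun _ _ => planeIdeal_isPrime _ _) (fun _ _ _ _ h => eq_of_planeIdeal_le h) hf hx

end Planes

section LinearParts

variable {k} {σ : Type}

open MvPolynomial

theorem eval_eq_zero_of_forall_ne_zero [Infinite k] (f : MvPolynomial σ k) (u w : σ → k)
    (h : ∀ s : k, s ≠ 0 → eval (u + s • w) f = 0) : eval u f = 0 := by
  let F : Polynomial k := aeval (fun i => Polynomial.C (u i) + Polynomial.X * Polynomial.C (w i)) f
  have hF (s : k) : F.eval s = eval (u + s • w) f := by
    have : (Polynomial.aeval s).comp (aeval fun i => Polynomial.C (u i) + Polynomial.X *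
        Polynomial.C (w i)) = aeval (R := k) (u + s • w) := algHom_ext fun v => by
          simpa using mul_comm (w v) s
    simpa [F, Polynomial.coe_aeval_eq_eval, aeval_eq_eval] using DFunLike.congr_fun this f
  have hzero : Polynomial.X * F = 0 := Polynomial.funext fun s => by
    by_cases hs : s = 0
    · rw [Polynomial.eval_mul, Polynomial.eval_X, hs, zero_mul, Polynomial.eval_zero]
    · rw [Polynomial.eval_mul, hF, h s hs, mul_zero, Polynomial.eval_zero]
  have h0 := hF 0
  rwa [(mul_eq_zero.1 hzero).resolve_left Polynomial.X_ne_zero, Polynomial.eval_zero, zero_smul,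
    add_zero, eq_comm] at h0

theorem exists_eq_sum_X_mul_of_mem_span [Fintype σ] {f : MvPolynomial σ k}
    (hf : f ∈ Ideal.span (Set.range (X : σ → MvPolynomial σ k))) :
    ∃ g : σ → MvPolynomial σ k, f = ∑ i, X i * g i := by
  obtain ⟨g, hg⟩ := Ideal.mem_span_range_iff_exists_fun.1 hf
  exact ⟨g, by simp [← hg, mul_comm]⟩

theorem mem_span_range_X_iff {f : MvPolynomial σ k} :
    f ∈ Ideal.span (Set.range (X : σ → MvPolynomial σ k)) ↔ eval 0 f = 0 := by
  constructor
  · intro hf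
    refine (Ideal.span_le (I := RingHom.ker (eval (0 : σ → k)))).2 ?_ hf
    rintro _ ⟨i, rfl⟩
    simp
  · intro hf
    rw [← Set.image_univ, mem_ideal_span_X_image]
    intro m hm
    by_contra! h
    have : m = 0 := Finsupp.ext fun i => h i (Set.mem_univ i)
    rw [mem_support_iff, this] at hm
    exact hm (by rwa [eval_zero] at hf)

theorem exists_eq_C_add_sum_X_mul [Fintype σ] (f : MvPolynomial σ k) :
    ∃ g : σ → MvPolynomial σ k, f = C (eval 0 f) + ∑ i, X i * g i := by
  obtain ⟨g, hg⟩ := exists_eq_sum_X_mul_of_mem_span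
    (f := f - C (eval 0 f)) (mem_span_range_X_iff.2 (by simp))
  exact ⟨g, by rw [← hg]; ring⟩

/-- If a polynomial vanishes on the line through `0` and `w`, so does its linear part. -/
theorem sum_mul_eval_zero_eq_zero [Infinite k] [Fintype σ] {g : σ → MvPolynomial σ k}
    {c : k} {w : σ → k} (h : ∀ r : k, eval (r • w) (C c + ∑ i, X i * g i) = 0) :
    ∑ i, w i * eval 0 (g i) = 0 := by
  have hc : c = 0 := by simpa using h 0
  have := eval_eq_zero_of_forall_ne_zero (∑ i, C (w i) * g i) 0 w fun s hs => by
    have h2 := h s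
    simp only [hc, map_zero, zero_add, map_sum, map_mul, eval_X, Pi.smul_apply, smul_eq_mul,
      mul_assoc, ← Finset.mul_sum, mul_eq_zero, hs, false_or] at h2
    simpa using h2
  simpa using this

end LinearParts

section LinearForms

variable {k} {σ τ : Type}

open MvPolynomial

/-- The linear form with coefficients `c`. -/
def linForm [Fintype σ] (c : σ → k) : MvPolynomial σ k :=
  ∑ i, C (c i) * X i

@[simp]
theorem eval_linForm [Fintype σ] (c x : σ → k) : eval x (linForm c) = c ⬝ᵥ x := by
  simp [linForm, dotProduct]

theorem isHomogeneous_linForm [Fintype σ] (c : σ → k) : (linForm c).IsHomogeneous 1 :=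
  IsHomogeneous.sum _ _ _ fun i _ => by
    simpa using (isHomogeneous_C σ (c i)).mul (isHomogeneous_X k i)

theorem linForm_eq_zero [Fintype σ] {c : σ → k} (h : linForm c = 0) : c = 0 := by
  classical
  ext i
  simpa [h] using (eval_linForm c (Pi.single i 1)).symm

@[simp]
theorem eval_elim_rename_inl (x : σ → k) (y : τ → k) (f : MvPolynomial σ k) :
    eval (Sum.elim x y) (rename Sum.inl f) = eval x f := by
  simp [eval_rename]

@[simp]
theorem eval_elim_rename_inr (x : σ → k) (y : τ → k) (f : MvPolynomial τ k) :
    eval (Sum.elim x y) (rename Sum.inr f) = eval y f := by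
  simp [eval_rename]

theorem Projectivization.exists_dotProduct_eq_one_zero {p q : Pt k 1} (h : p ≠ q) :
    ∃ c : Fin 2 → k, c ⬝ᵥ p.rep = 1 ∧ c ⬝ᵥ q.rep = 0 := by
  have hd : p.rep 0 * q.rep 1 - p.rep 1 * q.rep 0 ≠ 0 := fun hd => by
    have key : ∀ i j : Fin 2, p.rep i * q.rep j = p.rep j * q.rep i := by
      simp only [Fin.forall_fin_two]
      exact ⟨⟨trivial, by linear_combination hd⟩, by linear_combination -hd, trivial⟩
    exact h (eq_of_rep_mul_rep key)
  refine ⟨(p.rep 0 * q.rep 1 - p.rep 1 * q.rep 0)⁻¹ • ![q.rep 1, -q.rep 0], ?_, ?_⟩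
  · rw [smul_dotProduct, smul_eq_mul, inv_mul_eq_one₀ hd]
    simp [dotProduct, Fin.sum_univ_two]
    ring
  · rw [smul_dotProduct]
    simp [dotProduct, Fin.sum_univ_two]
    exact Or.inr (by ring)

theorem exists_dotProduct_ne_zero [Infinite k] {m : ℕ} {s : Set (Pt k m)} (hs : s.Finite) :
    ∃ c : Fin (m + 1) → k, ∀ q ∈ s, c ⬝ᵥ q.rep ≠ 0 := by
  have := hs.to_subtype
  obtain ⟨φ, hφ⟩ := Module.exists_dual_forall_apply_ne_zero (K := k)
    (fun q : s => q.1.rep) fun q => q.1.rep_nonzero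
  refine ⟨fun i => φ fun j => if i = j then 1 else 0, fun q hq => ?_⟩
  convert hφ ⟨q, hq⟩ using 1
  simp [dotProduct, LinearMap.pi_apply_eq_sum_univ φ q.rep, mul_comm]

theorem mem_vanishP {m : ℕ} {Z : Set (Pt k m)} {F : MvPolynomial (Fin (m + 1)) k} :
    F ∈ vanishP k Z ↔ ∀ q ∈ Z, ∀ r : k, eval (r • q.rep) F = 0 := by
  simp [vanishP, Submodule.mem_iInf]

theorem eval_smul_eq_zero_of_mul [Infinite k] {F : MvPolynomial σ k} {w : σ → k}
    (h : ∀ r : k, r * eval (r • w) F = 0) (r : k) : eval (r • w) F = 0 := by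
  have hne : ∀ s : k, s ≠ 0 → eval (s • w) F = 0 := fun s hs =>
    (mul_eq_zero.1 (h s)).resolve_left hs
  by_cases hr : r = 0
  · simpa [hr] using eval_eq_zero_of_forall_ne_zero F 0 w (by simpa using hne)
  · exact hne r hr

end LinearForms

section TwoFibres

variable {k}

open MvPolynomial RingTheory.Sequence

theorem mem_vanishP2_union_prod {a b : ℕ} {P₁ P₂ : Pt k a} {A B : Set (Pt k b)}
    {f : MvPolynomial (Fin (a + 1) ⊕ Fin (b + 1)) k} :
    f ∈ vanishP2 k ({P₁} ×ˢ A ∪ {P₂} ×ˢ B) ↔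
      (∀ q ∈ A, ∀ s t : k, eval (Sum.elim (s • P₁.rep) (t • q.rep)) f = 0) ∧
        ∀ q ∈ B, ∀ s t : k, eval (Sum.elim (s • P₂.rep) (t • q.rep)) f = 0 := by
  simp only [mem_vanishP2, mem_planeIdeal, Set.mem_union, Set.mem_prod, Set.mem_singleton_iff,
    Prod.forall]
  grind

/-- Two fibres over distinct points of `ℙ^1` form an ACM set of points as soon as the sum of the
ideals of the fibres is saturated. -/
theorem isACM_union_prod [Infinite k] {b : ℕ} {P₁ P₂ : Pt k 1} (hP : P₁ ≠ P₂)
    {A B : Set (Pt k b)} (hA : A.Finite) (hB : B.Finite) (hne : A.Nonempty)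
    (hAB : vanishP k (A ∩ B) ≤ vanishP k A ⊔ vanishP k B) :
    IsACM (vanishP2 k ({P₁} ×ˢ A ∪ {P₂} ×ˢ B)) := by
  obtain ⟨c, hc₁, hc₂⟩ := Projectivization.exists_dotProduct_eq_one_zero hP
  obtain ⟨d, hd₂, hd₁⟩ := Projectivization.exists_dotProduct_eq_one_zero hP.symm
  obtain ⟨l, hl⟩ := exists_dotProduct_ne_zero (hA.union hB)
  set I := vanishP2 k ({P₁} ×ˢ A ∪ {P₂} ×ˢ B) with hI
  let E : MvPolynomial (Fin 2 ⊕ Fin (b + 1)) k := rename Sum.inl (linForm c)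
  let f : MvPolynomial (Fin 2 ⊕ Fin (b + 1)) k := rename Sum.inl (linForm (c + d))
  let g : MvPolynomial (Fin 2 ⊕ Fin (b + 1)) k := rename Sum.inr (linForm l)
  have hE₁ (s : k) (y : Fin (b + 1) → k) : eval (Sum.elim (s • P₁.rep) y) E = s := by
    simp [E, hc₁]
  have hE₂ (s : k) (y : Fin (b + 1) → k) : eval (Sum.elim (s • P₂.rep) y) E = 0 := by
    simp [E, hc₂]
  have hf₁ (s : k) (y : Fin (b + 1) → k) : eval (Sum.elim (s • P₁.rep) y) f = s := by
    simp [f, hc₁, hd₁, add_dotProduct]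
  have hf₂ (s : k) (y : Fin (b + 1) → k) : eval (Sum.elim (s • P₂.rep) y) f = s := by
    simp [f, hc₂, hd₂, add_dotProduct]
  have hg (x : Fin 2 → k) (t : k) (q : Pt k b) :
      eval (Sum.elim x (t • q.rep)) g = t * (l ⬝ᵥ q.rep) := by
    simp [g]
  have hf₀ : eval 0 f = 0 := by
    rw [← Sum.elim_zero_zero, eval_elim_rename_inl, eval_linForm, dotProduct_zero]
  have hg₀ : eval 0 g = 0 := by
    rw [← Sum.elim_zero_zero, eval_elim_rename_inr, eval_linForm, dotProduct_zero]
  have hnormal (h : MvPolynomial (Fin 2 ⊕ Fin (b + 1)) k) :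
      ∃ (u v : MvPolynomial (Fin (b + 1)) k) (w : MvPolynomial (Fin 2 ⊕ Fin (b + 1)) k),
        h - (rename Sum.inr u + E * rename Sum.inr v + f * w) ∈ I := by
    induction h using MvPolynomial.induction_on with
    | C r => exact ⟨C r, 0, 0, by simp⟩
    | add h₁ h₂ ih₁ ih₂ =>
      obtain ⟨u₁, v₁, w₁, ih₁⟩ := ih₁
      obtain ⟨u₂, v₂, w₂, ih₂⟩ := ih₂
      refine ⟨u₁ + u₂, v₁ + v₂, w₁ + w₂, ?_⟩
      convert I.add_mem ih₁ ih₂ using 1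
      simp only [map_add]
      ring
    | mul_X h z ih =>
      obtain ⟨u, v, w, ih⟩ := ih
      rcases z with i | j
      · refine ⟨0, C (P₁.rep i - P₂.rep i) * u,
          w * X (Sum.inl i) + C (P₂.rep i) * rename Sum.inr u +
            C (P₁.rep i) * E * rename Sum.inr v, ?_⟩
        rw [← sub_add_cancel h (rename Sum.inr u + E * rename Sum.inr v + f * w), add_mul,
          add_sub_assoc]
        refine I.add_mem (I.mul_mem_right _ ih) (mem_vanishP2_union_prod.2 ⟨?_, ?_⟩)
        · intro q _ s t
          simp [hE₁, hf₁]
          ring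
        · intro q _ s t
          simp [hE₂, hf₂]
          ring
      · refine ⟨u * X j, v * X j, w * X (Sum.inr j), ?_⟩
        convert I.mul_mem_right (X (Sum.inr j)) ih using 1
        simp only [map_mul, rename_X]
        ring
  have hreg : IsWeaklyRegular (MvPolynomial (Fin 2 ⊕ Fin (b + 1)) k ⧸ I)
      [Ideal.Quotient.mk I f, Ideal.Quotient.mk I g] := by
    rw [isWeaklyRegular_mk_pair_iff]
    refine ⟨fun h hfh => ?_, fun h h' hgh => ?_⟩
    · rw [hI, mem_vanishP2] at hfh ⊢
      intro x hx
      refine ((planeIdeal_isPrime _ _).mem_or_mem (hfh x hx)).resolve_left fun hfx => ?_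
      have h1 := mem_planeIdeal.1 hfx 1 0
      rcases hx with hx | hx
      · rw [Set.mem_singleton_iff.1 hx.1, hf₁] at h1
        exact one_ne_zero h1
      · rw [Set.mem_singleton_iff.1 hx.1, hf₂] at h1
        exact one_ne_zero h1
    · obtain ⟨u, v, w, huv⟩ := hnormal h
      have hmem : g * (rename Sum.inr u + E * rename Sum.inr v) - f * (h' - g * w) ∈ I := by
        convert I.sub_mem hgh (I.mul_mem_left g huv) using 1
        ring
      obtain ⟨hmem₁, hmem₂⟩ := mem_vanishP2_union_prod.1 hmem
      have huA : ∀ q ∈ A, ∀ t : k, eval (t • q.rep) u = 0 := fun q hq =>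
        eval_smul_eq_zero_of_mul fun t => by
          have := hmem₁ q hq 0 t
          simp only [map_sub, map_mul, map_add, hE₁, hf₁, hg, eval_elim_rename_inr] at this
          simpa [hl q (Or.inl hq)] using this
      have huB : ∀ q ∈ B, ∀ t : k, eval (t • q.rep) u = 0 := fun q hq =>
        eval_smul_eq_zero_of_mul fun t => by
          have := hmem₂ q hq 0 t
          simp only [map_sub, map_mul, map_add, hE₂, hf₂, hg, eval_elim_rename_inr] at this
          simpa [hl q (Or.inr hq)] using this
      have hgv : ∀ q ∈ A, ∀ t : k, eval (Sum.elim (0 : Fin 2 → k) (t • q.rep))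
          (g * rename Sum.inr v - (h' - g * w)) = 0 := fun q hq t =>
        eval_eq_zero_of_forall_ne_zero _ _ (Sum.elim P₁.rep (0 : Fin (b + 1) → k)) fun s hs => by
          have hpt : Sum.elim (0 : Fin 2 → k) (t • q.rep) +
              s • Sum.elim P₁.rep (0 : Fin (b + 1) → k) =
              Sum.elim (s • P₁.rep) (t • q.rep) := by
            ext z; rcases z with z | z <;> simp
          have := hmem₁ q hq s t
          simp only [map_sub, map_mul, map_add, hE₁, hf₁, hg, eval_elim_rename_inr,
            huA q hq t] at this
          simp only [hpt, map_sub, map_mul, hg, eval_elim_rename_inr]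
          refine mul_left_cancel₀ hs ?_
          linear_combination this
      have hgw : ∀ q ∈ B, ∀ t : k, eval (Sum.elim (0 : Fin 2 → k) (t • q.rep))
          (h' - g * w) = 0 := fun q hq t =>
        eval_eq_zero_of_forall_ne_zero _ _ (Sum.elim P₂.rep (0 : Fin (b + 1) → k)) fun s hs => by
          have hpt : Sum.elim (0 : Fin 2 → k) (t • q.rep) +
              s • Sum.elim P₂.rep (0 : Fin (b + 1) → k) =
              Sum.elim (s • P₂.rep) (t • q.rep) := by
            ext z; rcases z with z | z <;> simp
          have := hmem₂ q hq s t
          simp only [map_sub, map_mul, map_add, hE₂, hf₂, hg, eval_elim_rename_inr,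
            huB q hq t] at this
          simp only [hpt, map_sub, map_mul, hg]
          refine mul_left_cancel₀ hs ?_
          linear_combination -this
      have hv : v ∈ vanishP k (A ∩ B) := mem_vanishP.2 fun q hq =>
        eval_smul_eq_zero_of_mul fun t => by
          have h1 := hgv q hq.1 t
          rw [map_sub, hgw q hq.2 t, map_mul, hg, eval_elim_rename_inr] at h1
          simpa [hl q (Or.inl hq.1)] using h1
      obtain ⟨vA, hvA, vB, hvB, rfl⟩ := Submodule.mem_sup.1 (hAB hv)
      rw [mem_vanishP] at hvA hvB
      refine ⟨w + rename Sum.inr vB, ?_⟩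
      have hrest : rename Sum.inr u + E * rename Sum.inr vA + (E - f) * rename Sum.inr vB ∈ I := by
        refine mem_vanishP2_union_prod.2 ⟨fun q hq s t => ?_, fun q hq s t => ?_⟩
        · simp [hE₁, hf₁, huA q hq, hvA q hq]
        · simp [hE₂, huB q hq, hvB q hq]
      convert I.add_mem huv hrest using 1
      simp only [map_add]
      ring
  have hmax : ∀ r ∈ [Ideal.Quotient.mk I f, Ideal.Quotient.mk I g],
      r ∈ Ideal.map (Ideal.Quotient.mk I) (Ideal.span (Set.range X)) := by
    simp only [List.mem_cons, List.not_mem_nil, or_false, forall_eq_or_imp, forall_eq]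
    exact ⟨Ideal.mem_map_of_mem _ (mem_span_range_X_iff.2 hf₀),
      Ideal.mem_map_of_mem _ (mem_span_range_X_iff.2 hg₀)⟩
  obtain ⟨q, hq⟩ := hne
  have hI₀ : ∀ F ∈ I, eval 0 F = 0 := fun F hF => by
    simpa using (mem_vanishP2_union_prod.1 hF).1 q hq 0 0
  refine ⟨_, hmax, isRegular_of_isWeaklyRegular_of_map_eq_zero
    (Ideal.Quotient.lift I (eval 0) hI₀) ?_ hreg, ?_⟩
  · simp only [List.mem_cons, List.not_mem_nil, or_false, forall_eq_or_imp, forall_eq,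
      Ideal.Quotient.lift_mk, hf₀, hg₀, and_self]
  · rw [hI, ringKrullDim_quotient_vanishP2
      (((Set.finite_singleton _).prod hA).union ((Set.finite_singleton _).prod hB))
      ⟨(P₁, q), Or.inl ⟨rfl, hq⟩⟩]
    rfl

end TwoFibres

section NotACM

variable {k}

open MvPolynomial RingTheory.Sequence

theorem mul_sub_mul_mem_of_mul_sub_mem {R : Type*} [CommRing R] {I : Ideal R} {r a b a' b' : R}
    (h : r * a - b ∈ I) (h' : r * a' - b' ∈ I) : a' * b - a * b' ∈ I := by
  convert I.sub_mem (I.mul_mem_left a h') (I.mul_mem_left a' h) using 1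
  ring

theorem Ideal.IsPrime.sub_mem_of_mul_sub_mem {R : Type*} [CommRing R] {I : Ideal R} (hI : I.IsPrime)
    {r a b c : R} (ha : a ∉ I) (h : r * a - b ∈ I) (h' : b - a * c ∈ I) : r - c ∈ I := by
  refine (hI.mem_or_mem (?_ : a * (r - c) ∈ I)).resolve_left ha
  convert I.add_mem h h' using 1
  ring

/-- The linear part in the second set of variables: it agrees with any linear form that agrees
with the polynomial on one of the planes. -/
theorem exists_linearPart [Infinite k] {a b : ℕ}
    (h : MvPolynomial (Fin (a + 1) ⊕ Fin (b + 1)) k) :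
    ∃ n : Fin (b + 1) → k, ∀ (p : Pt k a) (q : Pt k b) (l : Fin (b + 1) → k),
      rename Sum.inr (linForm l) - h ∈ planeIdeal p.rep q.rep → (l - n) ⬝ᵥ q.rep = 0 := by
  obtain ⟨c, hc⟩ := exists_eq_C_add_sum_X_mul h
  refine ⟨fun j => eval 0 (c (Sum.inr j)), fun p q l hl => ?_⟩
  have hline (r : k) :
      r • Sum.elim (0 : Fin (a + 1) → k) q.rep = Sum.elim ((0 : k) • p.rep) (r • q.rep) := by
    ext v; rcases v with v | v <;> simp
  have hL : h - rename Sum.inr (linForm l) = C (eval 0 h) +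
      ∑ v, X v * (c v - Sum.elim (0 : Fin (a + 1) → _) (fun j => C (l j)) v) := by
    have hl' : rename Sum.inr (linForm l) =
        ∑ v, X v * Sum.elim (0 : Fin (a + 1) → _) (fun j => C (l j)) v := by
      simp [linForm, mul_comm]
    simp only [mul_sub, Finset.sum_sub_distrib]
    rw [← hl', ← add_sub_assoc, ← hc]
  have := sum_mul_eval_zero_eq_zero (c := eval 0 h)
    (w := Sum.elim (0 : Fin (a + 1) → k) q.rep) fun r => by
      rw [← hL, hline, ← neg_sub, map_neg, mem_planeIdeal.1 hl, neg_zero]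
  simp only [Fintype.sum_sum_type, Sum.elim_inl, Sum.elim_inr, Pi.zero_apply, zero_mul,
    Finset.sum_const_zero, zero_add, map_sub, eval_C, mul_sub, Finset.sum_sub_distrib] at this
  simp only [dotProduct, Pi.sub_apply, mul_sub, Finset.sum_sub_distrib, mul_comm _ (q.rep _)]
  linear_combination -this

/-- A criterion for a set of points not to be ACM. The form `linForm l` on the plane over `(P, Q)`
and zero on the other planes is multiplied into the coordinate ring by the irrelevant ideal, but
does not come from the coordinate ring, because no linear form vanishes at the second coordinates
of the other points and not at `Q`. -/
theorem not_isACM_vanishP2 [Infinite k] {a b : ℕ} {Z : Set (Pt k a × Pt k b)} (hZ : Z.Finite)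
    {P : Pt k a} {Q : Pt k b} (hPQ : (P, Q) ∈ Z) {e : Fin (a + 1) → k} {l m : Fin (b + 1) → k}
    (he : e ⬝ᵥ P.rep = 1) (hl : l ⬝ᵥ Q.rep ≠ 0) (hm : m ⬝ᵥ Q.rep = 1)
    (hvan : ∀ x ∈ Z, x ≠ (P, Q) →
      l ⬝ᵥ x.2.rep = 0 ∨ e ⬝ᵥ x.1.rep = 0 ∧ m ⬝ᵥ x.2.rep = 0)
    (hspan : ∀ n : Fin (b + 1) → k,
      (∀ x ∈ Z, x ≠ (P, Q) → n ⬝ᵥ x.2.rep = 0) → n ⬝ᵥ Q.rep = 0) :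
    ¬ IsACM (vanishP2 k Z) := by
  rintro ⟨rs, hmax, hreg, hdim⟩
  rw [ringKrullDim_quotient_vanishP2 hZ ⟨_, hPQ⟩] at hdim
  obtain ⟨r₁, r₂, rfl⟩ := List.length_eq_two.1 (by exact_mod_cast hdim : rs.length = 2)
  obtain ⟨f, hf, rfl⟩ := (Ideal.mem_map_iff_of_surjective _ Ideal.Quotient.mk_surjective).1
    (hmax r₁ (by simp))
  obtain ⟨f', hf', rfl⟩ := (Ideal.mem_map_iff_of_surjective _ Ideal.Quotient.mk_surjective).1
    (hmax r₂ (by simp))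
  obtain ⟨hreg₁, hreg₂⟩ := (isWeaklyRegular_mk_pair_iff _ _ _).1 hreg.toIsWeaklyRegular
  obtain ⟨g, rfl⟩ := exists_eq_sum_X_mul_of_mem_span hf
  obtain ⟨g', rfl⟩ := exists_eq_sum_X_mul_of_mem_span hf'
  let E : MvPolynomial (Fin (a + 1) ⊕ Fin (b + 1)) k := rename Sum.inl (linForm e)
  let L : MvPolynomial (Fin (a + 1) ⊕ Fin (b + 1)) k := rename Sum.inr (linForm l)
  let M : MvPolynomial (Fin (a + 1) ⊕ Fin (b + 1)) k := rename Sum.inr (linForm m)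
  let D : Fin (a + 1) ⊕ Fin (b + 1) → MvPolynomial (Fin (a + 1) ⊕ Fin (b + 1)) k :=
    Sum.elim (fun i => C (P.rep i) * E) fun j => C (Q.rep j) * M
  have hDPQ (s t : k) (v : Fin (a + 1) ⊕ Fin (b + 1)) :
      eval (Sum.elim (s • P.rep) (t • Q.rep)) (D v) =
        Sum.elim (s • P.rep) (t • Q.rep) v := by
    rcases v with i | j <;> simp [D, E, M, he, hm, mul_comm]
  have hDvan {x : Pt k a × Pt k b} (hx : x ∈ Z) (hne : x ≠ (P, Q)) (s t : k)
      (v : Fin (a + 1) ⊕ Fin (b + 1)) :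
      eval (Sum.elim (s • x.1.rep) (t • x.2.rep)) (L * D v) = 0 := by
    rcases hvan x hx hne with h | ⟨h₁, h₂⟩
    · simp [L, h]
    · rcases v with i | j <;> simp [D, E, M, h₁, h₂]
  have hmul (c : Fin (a + 1) ⊕ Fin (b + 1) → MvPolynomial (Fin (a + 1) ⊕ Fin (b + 1)) k) :
      L * ∑ v, X v * c v - ∑ v, L * D v * c v ∈ planeIdeal P.rep Q.rep :=
    mem_planeIdeal.2 fun s t => by
      simp only [map_sub, map_mul, map_sum, eval_X, hDPQ, Finset.mul_sum, mul_assoc, sub_self]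
  have hmul_ne (c : Fin (a + 1) ⊕ Fin (b + 1) → MvPolynomial (Fin (a + 1) ⊕ Fin (b + 1)) k)
      {x : Pt k a × Pt k b} (hx : x ∈ Z) (hne : x ≠ (P, Q)) :
      ∑ v, L * D v * c v ∈ planeIdeal x.1.rep x.2.rep :=
    Ideal.sum_mem _ fun v _ => Ideal.mul_mem_right _ _ (mem_planeIdeal.2 (hDvan hx hne · · v))
  obtain ⟨h, hh⟩ := hreg₂ (∑ v, L * D v * g v) (∑ v, L * D v * g' v) <|
      mem_vanishP2.2 fun x hx => by
    by_cases hne : x = (P, Q)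
    · subst hne
      exact mul_sub_mul_mem_of_mul_sub_mem (hmul g) (hmul g')
    · exact Ideal.sub_mem _ (Ideal.mul_mem_left _ _ (hmul_ne g hx hne))
        (Ideal.mul_mem_left _ _ (hmul_ne g' hx hne))
  rw [mem_vanishP2] at hh
  have hres : L - h ∈ planeIdeal P.rep Q.rep := by
    have hg := notMem_planeIdeal_of_regular hZ hreg₁ hPQ
    have hgL := hmul g
    have hgh := hh _ hPQ
    generalize ∑ v, L * D v * g v = b at hgL hgh
    generalize ∑ v, X v * g v = a at hg hgL hgh
    exact (planeIdeal_isPrime _ _).sub_mem_of_mul_sub_mem hg hgL hgh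
  have hres_ne {x : Pt k a × Pt k b} (hx : x ∈ Z) (hne : x ≠ (P, Q)) :
      h ∈ planeIdeal x.1.rep x.2.rep := by
    have hg := notMem_planeIdeal_of_regular hZ hreg₁ hx
    have hgh := Ideal.sub_mem _ (hmul_ne g hx hne) (hh _ hx)
    rw [sub_sub_cancel] at hgh
    generalize ∑ v, X v * g v = a at hg hgh
    exact ((planeIdeal_isPrime _ _).mem_or_mem hgh).resolve_left hg
  obtain ⟨n, hn⟩ := exists_linearPart h
  have hQ := hspan n fun x hx hne => by
    simpa using hn x.1 x.2 0 (by simpa [linForm] using hres_ne hx hne)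
  have hQ' := hn P Q l hres
  rw [sub_dotProduct, hQ, sub_zero] at hQ'
  exact hl hQ'

end NotACM

section PlanePoints

variable {k}

open MvPolynomial

/-- For points no three of which are collinear, any two of them lie on a line that misses the others. -/
theorem exists_line_through_two {n : ℕ} {v : Fin n → Fin 3 → k}
    (hv : ∀ i j l, i ≠ j → i ≠ l → j ≠ l → ∀ c : Fin 3 → k,
      c ⬝ᵥ v i = 0 → c ⬝ᵥ v j = 0 → c ⬝ᵥ v l = 0 → c = 0) {i j : Fin n} (hij : i ≠ j) :
    ∃ c : Fin 3 → k, c ⬝ᵥ v i = 0 ∧ c ⬝ᵥ v j = 0 ∧ ∀ l, l ≠ i → l ≠ j → c ⬝ᵥ v l ≠ 0 := by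
  obtain ⟨c, hc, hne⟩ := (Submodule.ne_bot_iff _).1 <| LinearMap.ker_ne_bot_of_finrank_lt
    (f := Matrix.mulVecLin !![v i 0, v i 1, v i 2; v j 0, v j 1, v j 2]) (by simp)
  rw [LinearMap.mem_ker, Matrix.mulVecLin_apply] at hc
  have hi := congrFun hc 0
  have hj := congrFun hc 1
  simp [Matrix.mulVec, dotProduct, Fin.sum_univ_three] at hi hj
  have hi' : c ⬝ᵥ v i = 0 := by
    simp only [dotProduct, Fin.sum_univ_three]
    linear_combination hi
  have hj' : c ⬝ᵥ v j = 0 := by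
    simp only [dotProduct, Fin.sum_univ_three]
    linear_combination hj
  exact ⟨c, hi', hj', fun l hli hlj hl => hne (hv i j l hij hli.symm hlj.symm c hi' hj' hl)⟩

/-- A polynomial vanishing on lines through the origin that span the space has no constant and no
linear part. -/
theorem exists_eq_sum_X_mul_X_mul_of_vanish [Infinite k] {σ : Type} [Fintype σ] {S : Set (σ → k)}
    (hne : S.Nonempty) (hS : ∀ c : σ → k, (∀ w ∈ S, c ⬝ᵥ w = 0) → c = 0) {F : MvPolynomial σ k}
    (hF : ∀ w ∈ S, ∀ r : k, eval (r • w) F = 0) :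
    ∃ g : σ → σ → MvPolynomial σ k, F = ∑ i, ∑ j, X i * X j * g i j := by
  obtain ⟨g, hg⟩ := exists_eq_C_add_sum_X_mul F
  obtain ⟨w, hw⟩ := hne
  have h0 : eval 0 F = 0 := by simpa using hF w hw 0
  have hlin : (fun i => eval 0 (g i)) = 0 := hS _ fun w hw => by
    have := sum_mul_eval_zero_eq_zero (g := g) (c := eval 0 F) (w := w) fun r => by
      rw [← hg, hF w hw]
    simpa [dotProduct, mul_comm] using this
  choose g' hg' using fun i => exists_eq_C_add_sum_X_mul (g i)
  refine ⟨g', ?_⟩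
  rw [hg, h0, map_zero, zero_add]
  refine Finset.sum_congr rfl fun i _ => ?_
  conv_lhs => rw [hg' i, congrFun hlin i]
  simp [Finset.mul_sum, mul_assoc]

end PlanePoints

/-- **Example (ACM is not characterized by subconfigurations in `ℙ^1 × ℙ^2`).**
Let `P₁ ≠ P₂` be points of `ℙ^1` and `Q₁, …, Q₅` five generic points of `ℙ^2` (in general
position: pairwise distinct, no three collinear, every subset with generic Hilbert function).
Then `X′ = {P₁×Q₁, P₂×Q₂, P₁×Q₃, P₂×Q₃, P₁×Q₄, P₂×Q₄}` is not ACM, while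
`X″ = X′ ∪ {P₁×Q₅, P₂×Q₅}`, which contains `X′` as a subconfiguration, is ACM. -/
theorem six_points_not_ACM_eight_points_ACM [CharZero k]
    (P₁ P₂ : Pt k 1) (hP : P₁ ≠ P₂) (Q : Fin 5 → Pt k 2)
    (hQinj : Function.Injective Q)
    (hncol : ∀ i j l : Fin 5, i ≠ j → i ≠ l → j ≠ l →
      ∀ m : MvPolynomial (Fin (2 + 1)) k, m.IsHomogeneous 1 →
        (∀ s : k, MvPolynomial.eval (s • (Q i).rep) m = 0) →
        (∀ s : k, MvPolynomial.eval (s • (Q j).rep) m = 0) →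
        (∀ s : k, MvPolynomial.eval (s • (Q l).rep) m = 0) → m = 0)
    (hgen : ∀ Z : Set (Pt k 2), Z ⊆ Set.range Q → GenericHF k Z) :
    ¬ IsACM (vanishP2 k
        ({(P₁, Q 0), (P₂, Q 1), (P₁, Q 2), (P₂, Q 2), (P₁, Q 3), (P₂, Q 3)} :
          Set (Pt k 1 × Pt k 2))) ∧
    ({(P₁, Q 0), (P₂, Q 1), (P₁, Q 2), (P₂, Q 2), (P₁, Q 3), (P₂, Q 3)} :
        Set (Pt k 1 × Pt k 2)) ⊆
      ({(P₁, Q 0), (P₂, Q 1), (P₁, Q 2), (P₂, Q 2), (P₁, Q 3), (P₂, Q 3),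
        (P₁, Q 4), (P₂, Q 4)} : Set (Pt k 1 × Pt k 2)) ∧
    IsACM (vanishP2 k
        ({(P₁, Q 0), (P₂, Q 1), (P₁, Q 2), (P₂, Q 2), (P₁, Q 3), (P₂, Q 3),
          (P₁, Q 4), (P₂, Q 4)} : Set (Pt k 1 × Pt k 2))) := by
  have : Infinite k := CharZero.infinite k
  have hv : ∀ i j l, i ≠ j → i ≠ l → j ≠ l → ∀ c : Fin 3 → k,
      c ⬝ᵥ (Q i).rep = 0 → c ⬝ᵥ (Q j).rep = 0 → c ⬝ᵥ (Q l).rep = 0 → c = 0 :=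
    fun i j l hij hil hjl c hi hj hl => linForm_eq_zero <|
      hncol i j l hij hil hjl _ (isHomogeneous_linForm c) (by simp [hi]) (by simp [hj])
        (by simp [hl])
  refine ⟨?_, fun x hx => ?_, ?_⟩
  · obtain ⟨e, he₁, he₂⟩ := Projectivization.exists_dotProduct_eq_one_zero hP
    obtain ⟨l, hl₂, hl₃, hl⟩ := exists_line_through_two hv (show (2 : Fin 5) ≠ 3 by decide)
    obtain ⟨m, hm₁, -, hm⟩ := exists_line_through_two hv (show (1 : Fin 5) ≠ 2 by decide)
    have hm₀ := hm 0 (by decide) (by decide)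
    refine not_isACM_vanishP2 (Set.toFinite _) (P := P₁) (Q := Q 0) (e := e) (l := l)
      (m := (m ⬝ᵥ (Q 0).rep)⁻¹ • m) (by simp) he₁ (hl 0 (by decide) (by decide)) ?_ ?_ ?_
    · rw [smul_dotProduct, smul_eq_mul, inv_mul_cancel₀ hm₀]
    · simp only [Set.mem_insert_iff, Set.mem_singleton_iff, forall_eq_or_imp, forall_eq, hl₂, hl₃,
        he₂, smul_dotProduct, hm₁, smul_zero, true_or, and_self, or_true, implies_true, ne_eq,
        not_true_eq_false, IsEmpty.forall_iff]
    · intro n hn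
      have hn₀ : n = 0 := hv 1 2 3 (by decide) (by decide) (by decide) n
        (hn (P₂, Q 1) (by simp) (by simp [hQinj.eq_iff]))
        (hn (P₁, Q 2) (by simp) (by simp [hQinj.eq_iff]))
        (hn (P₁, Q 3) (by simp) (by simp [hQinj.eq_iff]))
      rw [hn₀, zero_dotProduct]
  · simp only [Set.mem_insert_iff, Set.mem_singleton_iff] at hx ⊢
    tauto
  · have hset : ({(P₁, Q 0), (P₂, Q 1), (P₁, Q 2), (P₂, Q 2), (P₁, Q 3), (P₂, Q 3), (P₁, Q 4),
        (P₂, Q 4)} : Set (Pt k 1 × Pt k 2)) =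
        {P₁} ×ˢ {Q 0, Q 2, Q 3, Q 4} ∪ {P₂} ×ˢ {Q 1, Q 2, Q 3, Q 4} := by
      ext ⟨p, q⟩
      simp only [Set.mem_insert_iff, Set.mem_singleton_iff, Prod.mk.injEq, Set.mem_union,
        Set.mem_prod]
      tauto
    rw [hset]
    refine isACM_union_prod hP (Set.toFinite _) (Set.toFinite _) ⟨Q 0, by simp⟩ fun F hF => ?_
    rw [mem_vanishP] at hF
    have hF₂ := hF (Q 2) (by simp)
    have hF₃ := hF (Q 3) (by simp)
    have hF₄ := hF (Q 4) (by simp)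
    obtain ⟨l, hl₀, hl₂, hl⟩ := exists_line_through_two hv (show (0 : Fin 5) ≠ 2 by decide)
    obtain ⟨m, hm₃, hm₄, hm⟩ := exists_line_through_two hv (show (3 : Fin 5) ≠ 4 by decide)
    have hl₁ := hl 1 (by decide) (by decide)
    have hm₁ := hm 1 (by decide) (by decide)
    obtain ⟨g, rfl⟩ := exists_eq_sum_X_mul_X_mul_of_vanish
      (S := {(Q 2).rep, (Q 3).rep, (Q 4).rep}) (by simp) (fun c hc =>
        hv 2 3 4 (by decide) (by decide) (by decide) c (hc _ (by simp)) (hc _ (by simp))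
          (hc _ (by simp))) (F := F) (by simp [hF₂, hF₃, hF₄])
    let H : MvPolynomial (Fin 3) k := linForm l * linForm m *
      MvPolynomial.C ((l ⬝ᵥ (Q 1).rep)⁻¹ * (m ⬝ᵥ (Q 1).rep)⁻¹) *
      ∑ i, ∑ j, MvPolynomial.C ((Q 1).rep i * (Q 1).rep j) * g i j
    refine Submodule.mem_sup.2 ⟨H, mem_vanishP.2 ?_, _, mem_vanishP.2 ?_, add_sub_cancel H _⟩
    · simp [H, hl₀, hl₂, hm₃, hm₄]
    · simp only [Set.mem_insert_iff, Set.mem_singleton_iff, forall_eq_or_imp, forall_eq, map_sub,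
        hF₂, hF₃, hF₄]
      refine ⟨fun r => ?_, by simp [H, hl₂], by simp [H, hm₃], by simp [H, hm₄]⟩
      have hr : r * (l ⬝ᵥ (Q 1).rep) * (r * (m ⬝ᵥ (Q 1).rep)) *
          ((l ⬝ᵥ (Q 1).rep)⁻¹ * (m ⬝ᵥ (Q 1).rep)⁻¹) = r * r := by
        field_simp
      simp only [H, map_mul, map_sum, eval_linForm, MvPolynomial.eval_C, MvPolynomial.eval_X,
        dotProduct_smul, smul_eq_mul, hr, Finset.mul_sum, Pi.smul_apply, ← Finset.sum_sub_distrib]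
      exact Finset.sum_eq_zero fun i _ => Finset.sum_eq_zero fun j _ => by ring

end
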